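/- arXiv:1310.5924 — 2 statements merged into one kernel-verified Lean document; each statement's English description precedes it below -/
import Mathlib

section
/- The volume of the polytope H_n = {z ∈ [-1,1]^n : z_1 ≥ 0, z_1+z_2 ≥ 0, ..., z_1+⋯+z_n ≥ 0} equals (1/2^n)·C(2n,n). -/
open MeasureTheory Finset

namespace HalfspacePolytope

/-- The convolution square of the central binomial coefficients is `4 ^ n`. -/
theorem sum_antidiagonal_centralBinom_mul (n : ℕ) :
    ∑ p ∈ antidiagonal n, p.1.centralBinom * p.2.centralBinom = 4 ^ n := by
  have weighted (n : ℕ) :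
      2 * ∑ p ∈ antidiagonal n, p.1 * (p.1.centralBinom * p.2.centralBinom) =
        n * ∑ p ∈ antidiagonal n, p.1.centralBinom * p.2.centralBinom := by
    have hswap : ∑ p ∈ antidiagonal n, p.1 * (p.1.centralBinom * p.2.centralBinom) =
        ∑ p ∈ antidiagonal n, p.2 * (p.1.centralBinom * p.2.centralBinom) := by
      rw [← Finset.Nat.sum_antidiagonal_swap]
      exact Finset.sum_congr rfl fun p _ => by simp [mul_comm]
    rw [two_mul]
    nth_rewrite 2 [hswap]
    rw [← Finset.sum_add_distrib, Finset.mul_sum]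
    refine Finset.sum_congr rfl fun p hp => ?_
    rw [← mem_antidiagonal.mp hp]
    ring
  induction n with
  | zero => simp
  | succ n ih =>
    have h := weighted (n + 1)
    have hstep : ∑ p ∈ antidiagonal n,
        (p.1 + 1) * ((p.1 + 1).centralBinom * p.2.centralBinom) =
        2 * (2 * ∑ p ∈ antidiagonal n, p.1 * (p.1.centralBinom * p.2.centralBinom)) +
          2 * ∑ p ∈ antidiagonal n, p.1.centralBinom * p.2.centralBinom := by
      simp only [Finset.mul_sum, ← Finset.sum_add_distrib]
      refine Finset.sum_congr rfl fun p _ => ?_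
      rw [← mul_assoc, Nat.succ_mul_centralBinom_succ]
      ring
    rw [weighted, ih] at hstep
    rw [Finset.Nat.sum_antidiagonal_succ] at h
    simp only [zero_mul, zero_add] at h
    rw [hstep] at h
    apply Nat.eq_of_mul_eq_mul_left n.succ_pos
    rw [Nat.succ_eq_add_one, ← h]
    ring

/-- A real sequence with positive first term is determined by its convolution square. -/
theorem eq_of_sum_antidiagonal_mul_eq {a b : ℕ → ℝ} (ha : 0 < a 0) (hb : 0 < b 0)
    (h : ∀ n, ∑ p ∈ antidiagonal n, a p.1 * a p.2 = ∑ p ∈ antidiagonal n, b p.1 * b p.2) :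
    a = b := by
  have hsq : PowerSeries.mk a ^ 2 = PowerSeries.mk b ^ 2 := by
    ext n
    simpa [sq, PowerSeries.coeff_mul] using h n
  rcases sq_eq_sq_iff_eq_or_eq_neg.mp hsq with hab | hab
  · funext n
    simpa using congrArg (PowerSeries.coeff n) hab
  · have := congrArg (PowerSeries.coeff 0) hab
    simp only [map_neg, PowerSeries.coeff_mk] at this
    linarith

/-- The sum of the first `j` coordinates of `z`. -/
noncomputable def partialSum {n : ℕ} (z : Fin n → ℝ) (j : ℕ) : ℝ :=
  ∑ i ∈ range j, if h : i < n then z ⟨i, h⟩ else 0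

@[simp]
theorem partialSum_zero {n : ℕ} (z : Fin n → ℝ) : partialSum z 0 = 0 := by
  simp [partialSum]

theorem partialSum_succ {n : ℕ} (z : Fin n → ℝ) {j : ℕ} (h : j < n) :
    partialSum z (j + 1) = partialSum z j + z ⟨j, h⟩ := by
  simp [partialSum, sum_range_succ, h]

theorem sum_Iic_eq_partialSum {n : ℕ} (z : Fin n → ℝ) (k : Fin n) :
    ∑ i ∈ Iic k, z i = partialSum z (k + 1) := by
  unfold partialSum
  refine Finset.sum_bij (fun i _ => (i : ℕ)) ?_ ?_ ?_ ?_
  · intro i hi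
    rw [mem_Iic, Fin.le_def] at hi
    rw [mem_range]
    omega
  · intro i _ j _ hij
    exact Fin.ext hij
  · intro i hi
    rw [mem_range] at hi
    exact ⟨⟨i, by omega⟩, by rw [mem_Iic, Fin.le_def]; simp only; omega, rfl⟩
  · intro i _
    simp

@[fun_prop]
theorem continuous_partialSum {n : ℕ} (j : ℕ) :
    Continuous fun z : Fin n → ℝ => partialSum z j := by
  unfold partialSum
  refine continuous_finsetSum _ fun i _ => ?_
  split_ifs <;> fun_prop

theorem partialSum_add {n : ℕ} (z w : Fin n → ℝ) (j : ℕ) :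
    partialSum (z + w) j = partialSum z j + partialSum w j := by
  unfold partialSum
  rw [← Finset.sum_add_distrib]
  exact Finset.sum_congr rfl fun i _ => by split_ifs <;> simp

theorem partialSum_smul {n : ℕ} (c : ℝ) (z : Fin n → ℝ) (j : ℕ) :
    partialSum (c • z) j = c * partialSum z j := by
  unfold partialSum
  rw [Finset.mul_sum]
  exact Finset.sum_congr rfl fun i _ => by split_ifs <;> simp

/-- The points of the cube `[-1, 1] ^ n` with nonnegative partial sums. -/
def polytope (n : ℕ) : Set (Fin n → ℝ) :=
  {z | (∀ i, z i ∈ Set.Icc (-1 : ℝ) 1) ∧ ∀ j ≤ n, 0 ≤ partialSum z j}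

/-- The points of the cube `[-1, 1] ^ n` whose partial sums are minimal at index `k`. -/
def minimalAt (n k : ℕ) : Set (Fin n → ℝ) :=
  {z | (∀ i, z i ∈ Set.Icc (-1 : ℝ) 1) ∧ ∀ j ≤ n, partialSum z k ≤ partialSum z j}

theorem isClosed_minimalAt (n k : ℕ) : IsClosed (minimalAt n k) := by
  simp only [minimalAt, Set.mem_Icc, Set.ofPred_and, Set.ofPred_forall]
  refine IsClosed.inter (isClosed_iInter fun i => ?_)
    (isClosed_iInter fun j => isClosed_iInter fun _ => ?_)
  · exact (isClosed_le (by fun_prop) (by fun_prop)).inter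
      (isClosed_le (by fun_prop) (by fun_prop))
  · exact isClosed_le (by fun_prop) (by fun_prop)

theorem polytope_eq_minimalAt (n : ℕ) : polytope n = minimalAt n 0 := by
  simp [polytope, minimalAt]

theorem volume_cube (n : ℕ) :
    volume {z : Fin n → ℝ | ∀ i, z i ∈ Set.Icc (-1 : ℝ) 1} = 2 ^ n := by
  have : {z : Fin n → ℝ | ∀ i, z i ∈ Set.Icc (-1 : ℝ) 1} =
      Set.univ.pi fun _ => Set.Icc (-1 : ℝ) 1 := by
    ext z
    simp only [Set.mem_ofPred_eq, Set.mem_univ_pi]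
  rw [this, volume_pi_pi]
  norm_num

theorem biUnion_minimalAt (n : ℕ) :
    ⋃ k ∈ range (n + 1), minimalAt n k =
      {z : Fin n → ℝ | ∀ i, z i ∈ Set.Icc (-1 : ℝ) 1} := by
  ext z
  simp only [Set.mem_iUnion, exists_prop, minimalAt, Set.mem_ofPred_eq]
  refine ⟨fun ⟨_, _, h, _⟩ => h, fun h => ?_⟩
  obtain ⟨k, hk, hmin⟩ :=
    Finset.exists_min_image (range (n + 1)) (partialSum z) ⟨0, by simp⟩
  exact ⟨k, hk, h, fun j hj => hmin j (by rw [mem_range]; omega)⟩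

theorem volume_partialSum_eq {n j k : ℕ} (hjk : j < k) (hk : k ≤ n) :
    volume {z : Fin n → ℝ | partialSum z j = partialSum z k} = 0 := by
  let L : Submodule ℝ (Fin n → ℝ) :=
    { carrier := {z | partialSum z j = partialSum z k}
      add_mem' := fun {z w} hz hw => by
        simp only [Set.mem_ofPred_eq] at hz hw ⊢
        rw [partialSum_add, partialSum_add, hz, hw]
      zero_mem' := by simp [partialSum]
      smul_mem' := fun c z hz => by
        simp only [Set.mem_ofPred_eq] at hz ⊢
        rw [partialSum_smul, partialSum_smul, hz] }
  refine Measure.addHaar_submodule volume L fun htop => ?_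
  have hmem : (fun _ => 1 : Fin n → ℝ) ∈ L := htop ▸ Submodule.mem_top
  have hval (m : ℕ) (hm : m ≤ n) : partialSum (fun _ => 1 : Fin n → ℝ) m = m := by
    induction m with
    | zero => simp
    | succ m ih => rw [partialSum_succ _ hm, ih (by omega)]; push_cast; rfl
  change partialSum _ j = partialSum _ k at hmem
  rw [hval j (by omega), hval k hk] at hmem
  exact hjk.ne (by exact_mod_cast hmem)

theorem aedisjoint_minimalAt {n j k : ℕ} (hj : j ≤ n) (hk : k ≤ n) (hjk : j ≠ k) :
    AEDisjoint volume (minimalAt n j) (minimalAt n k) := by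
  wlog h : j < k generalizing j k
  · exact (this hk hj hjk.symm (by omega)).symm
  exact measure_mono_null (fun z hz => le_antisymm (hz.1.2 k hk) (hz.2.2 j hj))
    (volume_partialSum_eq h hk)

/-- Cut a sequence of `k + m` reals after `k` terms, reversing and negating the first part. -/
def split (k m : ℕ) (z : Fin (k + m) → ℝ) : (Fin k → ℝ) × (Fin m → ℝ) :=
  (fun i => -z (Fin.castAdd m i.rev), fun j => z (Fin.natAdd k j))

theorem measurePreserving_split (k m : ℕ) : MeasurePreserving (split k m) := by
  let e : Fin (k + m) ≃ Fin k ⊕ Fin m :=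
    finSumFinEquiv.symm.trans (Equiv.sumCongr Fin.revPerm (Equiv.refl _))
  have hcut : MeasurePreserving
      fun z : Fin (k + m) → ℝ =>
        ((fun i => z (Fin.castAdd m i.rev), fun j => z (Fin.natAdd k j)) :
          (Fin k → ℝ) × (Fin m → ℝ)) := by
    have h := (volume_measurePreserving_sumPiEquivProdPi fun _ : Fin k ⊕ Fin m => ℝ).comp
      (volume_measurePreserving_piCongrLeft (fun _ : Fin k ⊕ Fin m => ℝ) e)
    refine (congrArg (MeasurePreserving · volume volume) (funext fun z => ?_)).mpr h
    refine Prod.ext (funext fun i => Eq.symm ?_) (funext fun i => Eq.symm ?_)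
    · have := Equiv.piCongrLeft_apply_apply (fun _ : Fin k ⊕ Fin m => ℝ) e z
        (Fin.castAdd m i.rev)
      rw [show e (Fin.castAdd m i.rev) = Sum.inl i by simp [e]] at this
      exact this
    · have := Equiv.piCongrLeft_apply_apply (fun _ : Fin k ⊕ Fin m => ℝ) e z
        (Fin.natAdd k i)
      rw [show e (Fin.natAdd k i) = Sum.inr i by simp [e]] at this
      exact this
  exact ((Measure.measurePreserving_neg (volume : Measure (Fin k → ℝ))).prod
    (MeasurePreserving.id (volume : Measure (Fin m → ℝ)))).comp hcut

theorem partialSum_split_fst {k m : ℕ} (z : Fin (k + m) → ℝ) {j : ℕ} (hj : j ≤ k) :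
    partialSum (split k m z).1 j = partialSum z (k - j) - partialSum z k := by
  induction j with
  | zero => simp
  | succ j ih =>
    have h := partialSum_succ z (j := k - (j + 1)) (by omega)
    rw [show k - (j + 1) + 1 = k - j by omega] at h
    rw [partialSum_succ _ (by omega), ih (by omega), h]
    simp only [split]
    have : Fin.castAdd m (Fin.rev ⟨j, hj⟩) = ⟨k - (j + 1), by omega⟩ := by
      ext
      simp
    rw [this]
    ring

theorem partialSum_split_snd {k m : ℕ} (z : Fin (k + m) → ℝ) {j : ℕ} (hj : j ≤ m) :
    partialSum (split k m z).2 j = partialSum z (k + j) - partialSum z k := by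
  induction j with
  | zero => simp
  | succ j ih =>
    rw [partialSum_succ _ (by omega), ih (by omega), ← add_assoc,
      partialSum_succ z (j := k + j) (by omega)]
    simp only [split, Fin.natAdd_mk]
    ring

theorem minimalAt_eq_preimage_split (k m : ℕ) :
    minimalAt (k + m) k = split k m ⁻¹' (polytope k ×ˢ polytope m) := by
  ext z
  simp only [minimalAt, polytope, Set.mem_preimage, Set.mem_prod, Set.mem_ofPred_eq]
  constructor
  · rintro ⟨hz, hmin⟩
    refine ⟨⟨fun i => ?_, fun j hj => ?_⟩, fun i => hz _, fun j hj => ?_⟩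
    · have := hz (Fin.castAdd m i.rev)
      simp only [split, Set.mem_Icc] at this ⊢
      constructor <;> linarith
    · rw [partialSum_split_fst z hj]
      linarith [hmin (k - j) (by omega)]
    · rw [partialSum_split_snd z hj]
      linarith [hmin (k + j) (by omega)]
  · rintro ⟨⟨hx, hxs⟩, hy, hys⟩
    refine ⟨fun i => ?_, fun j hj => ?_⟩
    · refine Fin.addCases (fun i => ?_) (fun i => hy i) i
      have := hx i.rev
      simp only [split, Fin.rev_rev, Set.mem_Icc] at this ⊢
      constructor <;> linarith
    · rcases le_total j k with hjk | hjk
      · have := hxs (k - j) (by omega)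
        rw [partialSum_split_fst z (by omega), Nat.sub_sub_self hjk] at this
        linarith
      · have := hys (j - k) (by omega)
        rw [partialSum_split_snd z (by omega), Nat.add_sub_cancel' hjk] at this
        linarith

theorem volume_minimalAt (k m : ℕ) :
    volume (minimalAt (k + m) k) = volume (polytope k) * volume (polytope m) := by
  have hmeas (n : ℕ) : MeasurableSet (polytope n) :=
    polytope_eq_minimalAt n ▸ (isClosed_minimalAt n 0).measurableSet
  rw [minimalAt_eq_preimage_split, (measurePreserving_split k m).measure_preimage
    ((hmeas k).prod (hmeas m)).nullMeasurableSet]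
  exact Measure.prod_prod _ _

theorem sum_antidiagonal_volume_polytope (n : ℕ) :
    ∑ p ∈ antidiagonal n, volume (polytope p.1) * volume (polytope p.2) = 2 ^ n := by
  rw [← volume_cube, ← biUnion_minimalAt, measure_biUnion_finset₀
    (fun j hj k hk hjk => aedisjoint_minimalAt
      (Nat.lt_succ_iff.mp (mem_range.mp hj)) (Nat.lt_succ_iff.mp (mem_range.mp hk)) hjk)
    fun k _ => (isClosed_minimalAt n k).measurableSet.nullMeasurableSet,
    ← Finset.Nat.sum_antidiagonal_eq_sum_range_succ_mk (fun p => volume (minimalAt n p.1))]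
  refine Finset.sum_congr rfl fun p hp => ?_
  rw [← volume_minimalAt, mem_antidiagonal.mp hp]

theorem volume_polytope_ne_top (n : ℕ) : volume (polytope n) ≠ ⊤ :=
  measure_ne_top_of_subset (s := {z : Fin n → ℝ | ∀ i, z i ∈ Set.Icc (-1 : ℝ) 1})
    (fun _ hz => hz.1) (by rw [volume_cube]; finiteness)

theorem volume_polytope_toReal (n : ℕ) :
    (volume (polytope n)).toReal = n.centralBinom / 2 ^ n := by
  refine congrFun (eq_of_sum_antidiagonal_mul_eq (a := fun n => (volume (polytope n)).toReal)
    (b := fun n => (n.centralBinom : ℝ) / 2 ^ n) ?_ (by simp) fun n => ?_) n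
  · have h := sum_antidiagonal_volume_polytope 0
    refine ENNReal.toReal_pos (fun h0 => ?_) (volume_polytope_ne_top 0)
    simp [h0] at h
  · have hvol := congrArg ENNReal.toReal (sum_antidiagonal_volume_polytope n)
    rw [ENNReal.toReal_sum fun p _ => ENNReal.mul_ne_top (volume_polytope_ne_top _)
      (volume_polytope_ne_top _)] at hvol
    simp only [ENNReal.toReal_mul, ENNReal.toReal_pow, ENNReal.toReal_ofNat] at hvol
    have hbinom : ∑ p ∈ antidiagonal n, (p.1.centralBinom : ℝ) * p.2.centralBinom = 4 ^ n := by
      exact_mod_cast sum_antidiagonal_centralBinom_mul n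
    have hterm : ∀ p ∈ antidiagonal n,
        (p.1.centralBinom : ℝ) / 2 ^ p.1 * (p.2.centralBinom / 2 ^ p.2) =
          p.1.centralBinom * p.2.centralBinom / 2 ^ n := fun p hp => by
      rw [← mem_antidiagonal.mp hp, pow_add, div_mul_div_comm]
    rw [hvol, Finset.sum_congr rfl hterm, ← Finset.sum_div, hbinom, ← div_pow]
    norm_num

end HalfspacePolytope

/-- The volume of the polytope
`H_n = {z ∈ [-1,1]^n : z_1 ≥ 0, z_1+z_2 ≥ 0, …, z_1+⋯+z_n ≥ 0}`
equals `(1/2^n)·C(2n,n)`. -/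
theorem volume_halfspace_polytope (n : ℕ) (hn : 0 < n) :
    MeasureTheory.volume {z : Fin n → ℝ |
        (∀ i, z i ∈ Set.Icc (-1 : ℝ) 1) ∧
        ∀ k : Fin n, 0 ≤ ∑ i ∈ Finset.Iic k, z i} =
      (Nat.choose (2 * n) n : ENNReal) / 2 ^ n := by
  have hset : {z : Fin n → ℝ | (∀ i, z i ∈ Set.Icc (-1 : ℝ) 1) ∧
      ∀ k : Fin n, 0 ≤ ∑ i ∈ Finset.Iic k, z i} = HalfspacePolytope.polytope n := by
    ext z
    simp only [HalfspacePolytope.polytope, Set.mem_ofPred_eq,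
      HalfspacePolytope.sum_Iic_eq_partialSum]
    refine and_congr_right fun _ => ⟨fun h j hj => ?_, fun h k => h _ k.isLt⟩
    cases j with
    | zero => simp
    | succ j => exact h ⟨j, hj⟩
  rw [hset, ← ENNReal.toReal_eq_toReal_iff' (HalfspacePolytope.volume_polytope_ne_top n)
    (by finiteness), HalfspacePolytope.volume_polytope_toReal]
  simp [Nat.centralBinom_eq_two_mul_choose]
end

section
/- The pushforward of the uniform (normalized surface area) measure on the unit sphere S² ⊂ ℝ³ under the z-coordinate map is the uniform measure on the interval [-1,1] (Archimedes' theorem). -/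
open MeasureTheory

/-- The (non-normalized) surface measure on the unit sphere in `ℝ³`: the
2-dimensional Hausdorff measure restricted to the sphere. -/
noncomputable def sphereSurfaceMeasure : Measure (EuclideanSpace ℝ (Fin 3)) :=
  (μH[2]).restrict (Metric.sphere (0 : EuclideanSpace ℝ (Fin 3)) 1)

open Set ENNReal Real

/-- Integration of a radial function over the plane, in the variable `s = x² + y² + c`. -/
lemma lintegral_plane_sq_add_sq_add (c : ℝ) {f : ℝ → ℝ≥0∞} (hf : Measurable f) :
    ∫⁻ p : ℝ × ℝ, f (p.1 ^ 2 + p.2 ^ 2 + c) = ENNReal.ofReal π * ∫⁻ s in Ioi c, f s := by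
  have himage : (fun r : ℝ => r ^ 2 + c) '' Ioi 0 = Ioi c := by
    ext s
    constructor
    · rintro ⟨r, hr, rfl⟩
      have : 0 < r ^ 2 := pow_pos hr 2
      simpa using this
    · intro hs
      have hs' : 0 < s - c := sub_pos.2 hs
      exact ⟨√(s - c), Real.sqrt_pos.2 hs', by simp [Real.sq_sqrt hs'.le]⟩
  have hsubst : ∫⁻ s in Ioi c, f s
      = ∫⁻ r in Ioi (0 : ℝ), ENNReal.ofReal (2 * r) * f (r ^ 2 + c) := by
    rw [← himage, lintegral_image_eq_lintegral_deriv_mul_of_monotoneOn (f' := fun r => 2 * r)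
      measurableSet_Ioi]
    · intro r _
      simpa using ((hasDerivAt_pow 2 r).add_const c).hasDerivWithinAt
    · intro a ha b _ hab
      have ha' : (0 : ℝ) ≤ a := le_of_lt ha
      dsimp only
      gcongr
  rw [← lintegral_comp_polarCoord_symm, hsubst, polarCoord_target, Measure.volume_eq_prod,
    ← Measure.prod_restrict, lintegral_prod _ (by fun_prop), ← lintegral_const_mul _ (by fun_prop)]
  refine setLIntegral_congr_fun measurableSet_Ioi fun r hr => ?_
  have hr' : (0 : ℝ) ≤ r := le_of_lt hr
  have hpolar (θ : ℝ) : (r * cos θ) ^ 2 + (r * sin θ) ^ 2 = r ^ 2 := by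
    nlinarith [sin_sq_add_cos_sq θ]
  simp only [polarCoord_symm_apply, hpolar, smul_eq_mul, lintegral_const, Measure.restrict_apply,
    MeasurableSet.univ, univ_inter, Real.volume_Ioo]
  rw [← mul_assoc, mul_right_comm, ← ENNReal.ofReal_mul hr', ← ENNReal.ofReal_mul pi_pos.le]
  congr 2
  ring

/-- Lebesgue measure on `ℝ³` as an iterated integral, with the last coordinate outside. -/
lemma lintegral_euclideanSpace_fin_three {F : ℝ → ℝ × ℝ → ℝ≥0∞}
    (hF : Measurable (Function.uncurry F)) :
    ∫⁻ v : EuclideanSpace ℝ (Fin 3), F (v 2) (v 0, v 1) = ∫⁻ z, ∫⁻ p, F z p := by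
  have h := ((((MeasurePreserving.id (volume : Measure ℝ)).prod
    (volume_preserving_finTwoArrow ℝ))).comp
    (volume_preserving_piFinSuccAbove (fun _ : Fin 3 => ℝ) 2)).comp
    (PiLp.volume_preserving_ofLp (Fin 3))
  exact (h.lintegral_comp hF).trans (lintegral_prod _ hF.aemeasurable)

/-- The volume of the part of the unit ball in `ℝ³` consisting of vectors whose direction has
last coordinate in `A` is proportional to the length of `A ∩ (-1, 1)`. -/
lemma exists_volume_ball_sector_eq : ∃ C : ℝ≥0∞, ∀ A : Set ℝ, MeasurableSet A →
    volume {v : EuclideanSpace ℝ (Fin 3) | ‖v‖ < 1 ∧ v 2 / ‖v‖ ∈ A}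
      = C * volume (A ∩ Ioo (-1) 1) := by
  classical
  refine ⟨ENNReal.ofReal π * ∫⁻ s in Ioo (0 : ℝ) 1, ENNReal.ofReal √s, fun A hA => ?_⟩
  let T : Set (ℝ × ℝ) := {q | q.2 < 1 ∧ q.1 / √q.2 ∈ A}
  have hT : MeasurableSet T :=
    (measurableSet_lt measurable_snd measurable_const).inter
      ((by fun_prop : Measurable fun q : ℝ × ℝ => q.1 / √q.2) hA)
  let G : ℝ → ℝ → ℝ≥0∞ := fun z s => T.indicator 1 (z, s)
  have hG : Measurable (Function.uncurry G) := measurable_one.indicator hT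
  have hGz (z : ℝ) : Measurable (G z) := hG.comp measurable_prodMk_left
  have hnorm (v : EuclideanSpace ℝ (Fin 3)) : ‖v‖ = √(v 0 ^ 2 + v 1 ^ 2 + v 2 ^ 2) := by
    simp [EuclideanSpace.norm_eq, Fin.sum_univ_three]
  have hset : MeasurableSet {v : EuclideanSpace ℝ (Fin 3) | ‖v‖ < 1 ∧ v 2 / ‖v‖ ∈ A} :=
    (measurableSet_lt measurable_norm measurable_const).inter
      ((by fun_prop : Measurable fun v : EuclideanSpace ℝ (Fin 3) => v 2 / ‖v‖) hA)
  have hlevel (s : ℝ) : ∫⁻ z, (Ioi (z ^ 2)).indicator (G z) s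
      = (Ioo 0 1).indicator (fun s => ENNReal.ofReal √s * volume (A ∩ Ioo (-1) 1)) s := by
    by_cases hs : s ∈ Ioo (0 : ℝ) 1
    · have hpos : 0 < √s := Real.sqrt_pos.2 hs.1
      rw [indicator_of_mem hs]
      have hvol := Real.volume_preimage_mul_left (inv_ne_zero hpos.ne') (A ∩ Ioo (-1) 1)
      rw [inv_inv, abs_of_pos hpos] at hvol
      rw [← hvol, ← lintegral_indicator_one
        ((measurable_const_mul _) (hA.inter measurableSet_Ioo))]
      refine lintegral_congr fun z => ?_
      have hz : z ^ 2 < s ↔ -1 < z / √s ∧ z / √s < 1 := by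
        rw [← abs_lt, abs_div, abs_of_pos hpos, div_lt_one hpos, Real.lt_sqrt (abs_nonneg z),
          sq_abs]
      have hmul : (√s)⁻¹ * z = z / √s := by rw [div_eq_inv_mul]
      simp only [G, T, indicator_apply, mem_Ioi, mem_ofPred_eq, mem_preimage, mem_inter_iff,
        mem_Ioo, hmul, hz, Pi.one_apply, hs.2, true_and]
      by_cases h1 : z / √s ∈ A <;> simp [h1]
    · rw [indicator_of_notMem hs, ← lintegral_zero (μ := (volume : Measure ℝ))]
      refine lintegral_congr fun z => ?_
      have : ¬ (z ^ 2 < s ∧ s < 1) := fun h => hs ⟨(sq_nonneg z).trans_lt h.1, h.2⟩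
      simp only [G, T, indicator_apply, mem_Ioi, mem_ofPred_eq, Pi.one_apply]
      split_ifs <;> simp_all
  calc volume {v : EuclideanSpace ℝ (Fin 3) | ‖v‖ < 1 ∧ v 2 / ‖v‖ ∈ A}
      = ∫⁻ v : EuclideanSpace ℝ (Fin 3), G (v 2) (v 0 ^ 2 + v 1 ^ 2 + v 2 ^ 2) := by
        rw [← lintegral_indicator_one hset]
        refine lintegral_congr fun v => ?_
        have hlt : ‖v‖ < 1 ↔ v 0 ^ 2 + v 1 ^ 2 + v 2 ^ 2 < 1 := by
          rw [hnorm, Real.sqrt_lt' one_pos, one_pow]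
        simp only [G, T, indicator_apply, mem_ofPred_eq, hlt, ← hnorm, Pi.one_apply]
    _ = ∫⁻ z, ∫⁻ p : ℝ × ℝ, G z (p.1 ^ 2 + p.2 ^ 2 + z ^ 2) :=
        lintegral_euclideanSpace_fin_three (F := fun z p => G z (p.1 ^ 2 + p.2 ^ 2 + z ^ 2))
          (hG.comp (by fun_prop : Measurable fun q : ℝ × ℝ × ℝ =>
            (q.1, q.2.1 ^ 2 + q.2.2 ^ 2 + q.1 ^ 2)))
    _ = ∫⁻ z, ENNReal.ofReal π * ∫⁻ s, (Ioi (z ^ 2)).indicator (G z) s := by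
        refine lintegral_congr fun z => ?_
        rw [lintegral_plane_sq_add_sq_add _ (hGz z),
          lintegral_indicator measurableSet_Ioi]
    _ = ENNReal.ofReal π * ∫⁻ s, ∫⁻ z, (Ioi (z ^ 2)).indicator (G z) s := by
        have hmeas : Measurable (Function.uncurry fun z s => (Ioi (z ^ 2)).indicator (G z) s) :=
          hG.indicator (measurableSet_lt (by fun_prop : Measurable fun q : ℝ × ℝ => q.1 ^ 2)
            measurable_snd)
        rw [lintegral_const_mul _ (by exact hmeas.lintegral_prod_right'),
          lintegral_lintegral_swap hmeas.aemeasurable]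
    _ = _ := by
        simp_rw [hlevel]
        rw [lintegral_indicator measurableSet_Ioo, lintegral_mul_const _ (by fun_prop), mul_assoc]

/-- The surface measure of the unit sphere is finite. -/
lemma sphereSurfaceMeasure_univ_lt_top : sphereSurfaceMeasure univ < ∞ := by
  let f : ℝ × ℝ → EuclideanSpace ℝ (Fin 3) := fun p =>
    !₂[cos p.1 * cos p.2, cos p.1 * sin p.2, sin p.1]
  have hf : ContDiff ℝ 1 f := by
    rw [contDiff_euclidean]
    intro i
    fin_cases i <;> simp [f] <;> fun_prop
  let K : Set (ℝ × ℝ) := Icc (-π) π ×ˢ Icc (-π) π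
  obtain ⟨C, hC⟩ := hf.contDiffOn.exists_lipschitzOnWith one_ne_zero
    ((convex_Icc (-π) π).prod (convex_Icc (-π) π)) (isCompact_Icc.prod isCompact_Icc)
  have hcover : Metric.sphere (0 : EuclideanSpace ℝ (Fin 3)) 1 ⊆ f '' K := by
    intro v hv
    have hv1 : v 0 ^ 2 + v 1 ^ 2 + v 2 ^ 2 = 1 := by
      have := EuclideanSpace.norm_sq_eq v
      rw [mem_sphere_zero_iff_norm.1 hv] at this
      simpa [Fin.sum_univ_three] using this.symm
    let w : ℂ := ⟨v 0, v 1⟩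
    have hw : ‖w‖ = cos (arcsin (v 2)) := by
      rw [cos_arcsin, Complex.norm_def, Complex.normSq_mk]
      congr 1
      linarith
    have hlow := neg_pi_div_two_le_arcsin (v 2)
    have hupp := arcsin_le_pi_div_two (v 2)
    refine ⟨(arcsin (v 2), w.arg), ⟨⟨?_, ?_⟩, (Complex.neg_pi_lt_arg w).le, Complex.arg_le_pi w⟩, ?_⟩
    · dsimp only; linarith [pi_pos]
    · dsimp only; linarith [pi_pos]
    · ext i
      fin_cases i
      · simp [f, ← hw, Complex.norm_mul_cos_arg, w]
      · simp [f, ← hw, Complex.norm_mul_sin_arg, w]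
      · simp only [f]
        exact sin_arcsin (by nlinarith [sq_nonneg (v 0), sq_nonneg (v 1)])
          (by nlinarith [sq_nonneg (v 0), sq_nonneg (v 1)])
  rw [sphereSurfaceMeasure, Measure.restrict_apply_univ]
  refine (measure_mono hcover).trans_lt ((hC.hausdorffMeasure_image_le zero_le_two).trans_lt ?_)
  rw [hausdorffMeasure_prod_real]
  exact ENNReal.mul_lt_top (by simp)
    (isCompact_Icc.prod isCompact_Icc).measure_lt_top

/-- The surface measure of the unit sphere is positive. -/
lemma sphereSurfaceMeasure_univ_ne_zero : sphereSurfaceMeasure univ ≠ 0 := by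
  let f : EuclideanSpace ℝ (Fin 3) → ℝ × ℝ := fun v => (v 0, v 1)
  have hf : LipschitzWith 1 f := by
    refine LipschitzWith.of_dist_le_mul fun v w => ?_
    rw [NNReal.coe_one, one_mul, Prod.dist_eq, dist_eq_norm v w]
    exact max_le (PiLp.norm_apply_le (v - w) 0) (PiLp.norm_apply_le (v - w) 1)
  have hcover : Icc (0 : ℝ) (1 / 2) ×ˢ Icc (0 : ℝ) (1 / 2)
      ⊆ f '' Metric.sphere (0 : EuclideanSpace ℝ (Fin 3)) 1 := by
    rintro ⟨a, b⟩ ⟨⟨ha0, ha⟩, hb0, hb⟩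
    dsimp only at ha0 ha hb0 hb
    refine ⟨!₂[a, b, √(1 - a ^ 2 - b ^ 2)], ?_, by simp [f]⟩
    rw [mem_sphere_zero_iff_norm, EuclideanSpace.norm_eq, Real.sqrt_eq_one]
    simp only [Fin.sum_univ_three, Real.norm_eq_abs, sq_abs]
    have : √(1 - a ^ 2 - b ^ 2) ^ 2 = 1 - a ^ 2 - b ^ 2 := Real.sq_sqrt (by nlinarith)
    simp [this]
  intro h
  rw [sphereSurfaceMeasure, Measure.restrict_apply_univ] at h
  have hzero : (volume : Measure (ℝ × ℝ)) (Icc (0 : ℝ) (1 / 2) ×ˢ Icc (0 : ℝ) (1 / 2)) = 0 := by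
    rw [← hausdorffMeasure_prod_real]
    refine measure_mono_null hcover (nonpos_iff_eq_zero.1 ?_)
    simpa [h] using hf.hausdorffMeasure_image_le zero_le_two
      (Metric.sphere (0 : EuclideanSpace ℝ (Fin 3)) 1)
  rw [Measure.volume_eq_prod, Measure.prod_prod] at hzero
  simp at hzero

/-- The surface measure of the unit sphere is invariant under linear isometries. -/
lemma sphereSurfaceMeasure_preimage (L : EuclideanSpace ℝ (Fin 3) ≃ₗᵢ[ℝ] EuclideanSpace ℝ (Fin 3))
    {s : Set (EuclideanSpace ℝ (Fin 3))} (hs : MeasurableSet s) :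
    sphereSurfaceMeasure (L ⁻¹' s) = sphereSurfaceMeasure s := by
  rw [sphereSurfaceMeasure, Measure.restrict_apply (L.continuous.measurable hs),
    Measure.restrict_apply hs, ← L.toIsometryEquiv.hausdorffMeasure_preimage 2 (s ∩ _)]
  congr 1
  ext v
  simp

/-- A measure invariant under linear isometries has the same marginal along all vectors of the
same norm. -/
lemma measure_inner_preimage_eq_of_norm_eq {E : Type*} [NormedAddCommGroup E]
    [InnerProductSpace ℝ E] [MeasurableSpace E] [BorelSpace E]
    {μ : Measure E} (hμ : ∀ (L : E ≃ₗᵢ[ℝ] E) (s : Set E), MeasurableSet s → μ (L ⁻¹' s) = μ s)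
    {u w : E} (huw : ‖u‖ = ‖w‖) {A : Set ℝ} (hA : MeasurableSet A) :
    μ {x | inner ℝ x u ∈ A} = μ {x | inner ℝ x w ∈ A} := by
  let L : E ≃ₗᵢ[ℝ] E := (ℝ ∙ (u - w))ᗮ.reflection
  have hL : L u = w := Submodule.reflection_sub huw
  rw [← hμ L {x | inner ℝ x w ∈ A}
    ((by fun_prop : Continuous fun x : E => inner ℝ x w).measurable hA)]
  congr 1
  ext x
  simp only [mem_ofPred_eq, mem_preimage, ← hL, L.inner_map_map]

/-- Two finite measures invariant under linear isometries, one of them carried by the unit sphere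
and the other without mass at the origin, have proportional distributions of the cosine of the
angle with a fixed unit vector. -/
lemma measure_univ_mul_measure_inner_div_norm {E : Type*} [NormedAddCommGroup E]
    [InnerProductSpace ℝ E] [MeasurableSpace E] [BorelSpace E] [SecondCountableTopology E]
    {μ ν : Measure E} [IsFiniteMeasure μ] [IsFiniteMeasure ν]
    (hμ : ∀ (L : E ≃ₗᵢ[ℝ] E) (s : Set E), MeasurableSet s → μ (L ⁻¹' s) = μ s)
    (hν : ∀ (L : E ≃ₗᵢ[ℝ] E) (s : Set E), MeasurableSet s → ν (L ⁻¹' s) = ν s)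
    (hμ1 : ∀ᵐ x ∂μ, ‖x‖ = 1) (hν0 : ν {0} = 0)
    {e : E} (he : ‖e‖ = 1) {A : Set ℝ} (hA : MeasurableSet A) :
    μ univ * ν {v | inner ℝ v e / ‖v‖ ∈ A} = ν univ * μ {x | inner ℝ x e ∈ A} := by
  have hmeas : Measurable fun q : E × E => inner ℝ q.1 q.2 / ‖q.2‖ :=
    (by fun_prop : Continuous fun q : E × E => (inner ℝ q.1 q.2 : ℝ)).measurable.div
      (by fun_prop)
  have hprod : MeasurableSet {q : E × E | inner ℝ q.1 q.2 / ‖q.2‖ ∈ A} := hmeas hA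
  have hleft : (μ.prod ν) {q | inner ℝ q.1 q.2 / ‖q.2‖ ∈ A}
      = μ univ * ν {v | inner ℝ v e / ‖v‖ ∈ A} := by
    rw [Measure.prod_apply hprod, mul_comm, ← lintegral_const]
    refine lintegral_congr_ae ?_
    filter_upwards [hμ1] with x hx
    let L : E ≃ₗᵢ[ℝ] E := (ℝ ∙ (x - e))ᗮ.reflection
    have hL : L x = e := Submodule.reflection_sub (hx.trans he.symm)
    have hset : MeasurableSet {v : E | inner ℝ v e / ‖v‖ ∈ A} :=
      ((by fun_prop : Continuous fun v : E => (inner ℝ v e : ℝ)).measurable.div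
        (by fun_prop : Measurable fun v : E => ‖v‖)) hA
    rw [← hν L _ hset]
    congr 1
    ext v
    simp only [mem_ofPred_eq, mem_preimage, ← hL, L.inner_map_map, L.norm_map,
      real_inner_comm]
  have hright : (μ.prod ν) {q | inner ℝ q.1 q.2 / ‖q.2‖ ∈ A}
      = ν univ * μ {x | inner ℝ x e ∈ A} := by
    rw [Measure.prod_apply_symm hprod, mul_comm, ← lintegral_const]
    refine lintegral_congr_ae ?_
    filter_upwards [measure_eq_zero_iff_ae_notMem.1 hν0] with v hv
    have hv' : ‖v‖ ≠ 0 := norm_ne_zero_iff.2 (by simpa using hv)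
    rw [← measure_inner_preimage_eq_of_norm_eq hμ (u := ‖v‖⁻¹ • v)
      (by rw [norm_smul, norm_inv, norm_norm, inv_mul_cancel₀ hv', he]) hA]
    congr 1
    ext x
    simp only [mem_ofPred_eq, mem_preimage, inner_smul_right, div_eq_inv_mul]
  exact hleft.symm.trans hright

/-- Archimedes' theorem: the pushforward of the uniform (normalized surface area)
measure on the unit sphere `S² ⊂ ℝ³` under the `z`-coordinate map is the uniform
measure on `[-1,1]` (Lebesgue measure divided by 2). -/
theorem archimedes_pushforward :
    Measure.map (fun x : EuclideanSpace ℝ (Fin 3) => x 2)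
        ((sphereSurfaceMeasure Set.univ)⁻¹ • sphereSurfaceMeasure) =
      (2 : ENNReal)⁻¹ • MeasureTheory.volume.restrict (Set.Icc (-1 : ℝ) 1) := by
  have hS0 := sphereSurfaceMeasure_univ_ne_zero
  have hSt := sphereSurfaceMeasure_univ_lt_top
  have : IsFiniteMeasure sphereSurfaceMeasure := ⟨hSt⟩
  let B : Set (EuclideanSpace ℝ (Fin 3)) := Metric.ball 0 1
  let ν : Measure (EuclideanSpace ℝ (Fin 3)) := volume.restrict B
  have hBt : volume B ≠ ∞ := measure_ball_lt_top.ne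
  have hB0 : volume B ≠ 0 := (Metric.measure_ball_pos _ _ one_pos).ne'
  have : IsFiniteMeasure ν := ⟨by simpa [ν] using hBt.lt_top⟩
  obtain ⟨C, hC⟩ := exists_volume_ball_sector_eq
  have hν (L : EuclideanSpace ℝ (Fin 3) ≃ₗᵢ[ℝ] EuclideanSpace ℝ (Fin 3))
      (s : Set (EuclideanSpace ℝ (Fin 3))) (hs : MeasurableSet s) : ν (L ⁻¹' s) = ν s := by
    rw [Measure.restrict_apply (L.continuous.measurable hs), Measure.restrict_apply hs,
      ← L.measurePreserving.measure_preimage (hs.inter measurableSet_ball).nullMeasurableSet]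
    congr 1
    ext v
    simp [B]
  have hball : volume B = C * 2 := by
    have h := hC univ MeasurableSet.univ
    norm_num [Real.volume_Ioo] at h
    rw [← h]
    congr 1
    ext v
    simp [B]
  have hsphere : ∀ᵐ x ∂sphereSurfaceMeasure, ‖x‖ = 1 := by
    filter_upwards [ae_restrict_mem Metric.isClosed_sphere.measurableSet] with x hx
    exact mem_sphere_zero_iff_norm.1 hx
  have hC0 : C ≠ 0 := by
    rintro rfl
    simp [hball] at hB0
  have hCt : C ≠ ∞ := by
    rintro rfl
    simp [hball] at hBt
  ext A hA
  have key := measure_univ_mul_measure_inner_div_norm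
    (fun L s hs => sphereSurfaceMeasure_preimage L hs) hν hsphere (measure_singleton 0)
    (e := EuclideanSpace.single 2 1) (by simp) hA
  have hsector : ν {v | inner ℝ v (EuclideanSpace.single 2 1) / ‖v‖ ∈ A}
      = C * volume (A ∩ Ioo (-1) 1) := by
    rw [← hC A hA, Measure.restrict_apply' measurableSet_ball]
    congr 1
    ext v
    simp [EuclideanSpace.inner_single_right, and_comm]
  have hcoord : {x : EuclideanSpace ℝ (Fin 3) | inner ℝ x (EuclideanSpace.single 2 (1 : ℝ)) ∈ A}
      = (fun x : EuclideanSpace ℝ (Fin 3) => x 2) ⁻¹' A := by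
    ext x
    simp [EuclideanSpace.inner_single_right]
  rw [hsector, hcoord, Measure.restrict_apply_univ, hball, mul_left_comm, mul_assoc,
    ENNReal.mul_right_inj hC0 hCt] at key
  rw [Measure.map_apply (by fun_prop) hA, Measure.smul_apply, Measure.smul_apply,
    ← restrict_Ioo_eq_restrict_Icc, Measure.restrict_apply hA, smul_eq_mul, smul_eq_mul]
  refine (ENNReal.mul_right_inj two_ne_zero ofNat_ne_top).1 ?_
  rw [mul_left_comm, ← key, ← mul_assoc, ENNReal.inv_mul_cancel hS0 hSt.ne, ← mul_assoc,
    ENNReal.mul_inv_cancel two_ne_zero ofNat_ne_top]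
end
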